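/- arXiv:1703.06653 — 4 statements merged into one kernel-verified Lean document; each statement's English description precedes it below -/
import Mathlib

section
/- Let φ_x, φ_y, φ_z be the field automorphisms of ℚ(x,y,z) determined by φ_x: x ↦ (yz²+y²+z)/(xyz), y ↦ y, z ↦ z; φ_y: x ↦ x, y ↦ z/y, z ↦ z; φ_z: x ↦ x, y ↦ y, z ↦ y/z. Then the subgroup of the automorphism group of ℚ(x,y,z) generated by φ_x, φ_y, φ_z is isomorphic to the dihedral group of order 12. -/
noncomputable section

/-- The field `ℚ(x,y,z)` of rational functions in three variables. -/
abbrev K : Type := FractionRing (MvPolynomial (Fin 3) ℚ)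

/-- The variables `x = Xv 0`, `y = Xv 1`, `z = Xv 2` of `ℚ(x,y,z)`. -/
def Xv (i : Fin 3) : K := algebraMap (MvPolynomial (Fin 3) ℚ) K (MvPolynomial.X i)

namespace DihedralGroup

variable {G : Type*} [Group G] {n : ℕ}

/-- The powers of an element `g` with `g ^ n = 1`, with exponents in `ZMod n`. -/
def zmodPowersHom (g : G) (hg : g ^ n = 1) : ZMod n →+ Additive G :=
  ZMod.lift n ⟨zmultiplesHom (Additive G) (Additive.ofMul g), by
    simp [← ofMul_pow, hg]⟩

theorem zmodPowersHom_intCast (g : G) (hg : g ^ n = 1) (i : ℤ) :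
    (zmodPowersHom g hg i).toMul = g ^ i := by
  simp [zmodPowersHom]

theorem toMul_zmodPowersHom_mul_eq {g s : G} (hg : g ^ n = 1) (h : s * g * s⁻¹ = g⁻¹)
    (i : ZMod n) :
    (zmodPowersHom g hg i).toMul * s = s * (zmodPowersHom g hg (-i)).toMul := by
  obtain ⟨k, rfl⟩ := ZMod.intCast_surjective i
  rw [← Int.cast_neg, zmodPowersHom_intCast, zmodPowersHom_intCast]
  have hc : s * g ^ (-k) * s⁻¹ = g ^ k := by
    rw [← conj_zpow, h, inv_zpow', neg_neg]
  rw [← hc, inv_mul_cancel_right]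

/-- The homomorphism from a dihedral group determined by the images `g` and `s` of `r 1`
and `sr 0`. -/
def lift (g s : G) (hg : g ^ n = 1) (hs : s * s = 1) (h : s * g * s⁻¹ = g⁻¹) :
    DihedralGroup n →* G where
  toFun
    | r i => (zmodPowersHom g hg i).toMul
    | sr i => s * (zmodPowersHom g hg i).toMul
  map_one' := by simp [one_def, -r_zero]
  map_mul' := by
    rintro (i | i) (j | j)
    · simp
    · simp only [r_mul_sr]
      rw [← mul_assoc, toMul_zmodPowersHom_mul_eq hg h, mul_assoc, ← toMul_add,
        ← map_add, neg_add_eq_sub]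
    · simp [mul_assoc]
    · simp only [sr_mul_sr]
      rw [mul_assoc, ← mul_assoc _ s, toMul_zmodPowersHom_mul_eq hg h, mul_assoc,
        ← mul_assoc s s, hs, one_mul, ← toMul_add, ← map_add, neg_add_eq_sub]

variable {g s : G} (hg : g ^ n = 1) (hs : s * s = 1) (h : s * g * s⁻¹ = g⁻¹)

theorem lift_r_intCast (i : ℤ) : lift g s hg hs h (r i) = g ^ i :=
  zmodPowersHom_intCast g hg i

theorem lift_sr_intCast (i : ℤ) : lift g s hg hs h (sr i) = s * g ^ i :=
  congrArg (s * ·) (zmodPowersHom_intCast g hg i)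

theorem lift_injective (hord : orderOf g = n) (hmem : s ∉ Subgroup.zpowers g) :
    Function.Injective (lift g s hg hs h) := by
  rw [injective_iff_map_eq_one]
  rintro (i | i) hi
  · obtain ⟨k, rfl⟩ := ZMod.intCast_surjective i
    rw [lift_r_intCast, ← orderOf_dvd_iff_zpow_eq_one, hord] at hi
    rw [(ZMod.intCast_zmod_eq_zero_iff_dvd k n).2 hi, r_zero]
  · obtain ⟨k, rfl⟩ := ZMod.intCast_surjective i
    rw [lift_sr_intCast, mul_eq_one_iff_eq_inv, ← zpow_neg] at hi
    exact absurd ⟨-k, hi.symm⟩ hmem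

theorem range_lift : (lift g s hg hs h).range = Subgroup.closure {g, s} := by
  apply le_antisymm
  · have hg' : g ∈ Subgroup.closure {g, s} := Subgroup.subset_closure (by simp)
    have hs' : s ∈ Subgroup.closure {g, s} := Subgroup.subset_closure (by simp)
    rintro _ ⟨i | i, rfl⟩ <;> obtain ⟨k, rfl⟩ := ZMod.intCast_surjective i
    · rw [lift_r_intCast]
      exact zpow_mem hg' k
    · rw [lift_sr_intCast]
      exact mul_mem hs' (zpow_mem hg' k)
  · rw [Subgroup.closure_le]
    rintro _ (rfl | rfl)
    · exact ⟨r (1 : ℤ), by rw [lift_r_intCast, zpow_one]⟩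
    · exact ⟨sr (0 : ℤ), by rw [lift_sr_intCast, zpow_zero, mul_one]⟩

end DihedralGroup

/-- Three involutions, the first commuting with the other two and those two generating a
copy of `S₃`, generate a dihedral group of order 12. -/
theorem nonempty_closure_mulEquiv_dihedralGroup_six {G : Type*} [Group G] {a b c : G}
    (ha : a * a = 1) (hb : b * b = 1) (hc : c * c = 1) (hab : Commute a b)
    (hac : Commute a c) (hbc : (b * c) ^ 3 = 1) (ha1 : a ≠ 1) (hne : b ≠ c) :
    Nonempty (Subgroup.closure {a, b, c} ≃* DihedralGroup 6) := by
  have hcomm : Commute a (b * c) := hab.mul_right hac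
  have ha' : a⁻¹ = a := inv_eq_of_mul_eq_one_right ha
  have hb' : b⁻¹ = b := inv_eq_of_mul_eq_one_right hb
  have hc' : c⁻¹ = c := inv_eq_of_mul_eq_one_right hc
  have ha2 : a ^ 2 = 1 := by rw [sq, ha]
  have h3 : (a * (b * c)) ^ 3 = a := by
    rw [hcomm.mul_pow, hbc, mul_one, pow_succ, ha2, one_mul]
  have h4 : (a * (b * c)) ^ 4 = b * c := by
    rw [hcomm.mul_pow, pow_succ (b * c), hbc, one_mul, pow_mul a 2 2, ha2, one_pow, one_mul]
  have h6 : (a * (b * c)) ^ 6 = 1 := by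
    rw [pow_mul _ 3 2, h3, ha2]
  have h2 : (a * (b * c)) ^ 2 ≠ 1 := fun h => hne <| by
    rw [← hc', ← mul_eq_one_iff_eq_inv, ← h4, pow_mul _ 2 2, h, one_pow]
  have hconj : b * (a * (b * c)) * b⁻¹ = (a * (b * c))⁻¹ := by
    rw [mul_inv_rev, mul_inv_rev, ha', hb', hc', ← mul_assoc b a, ← hab.eq, mul_assoc a b,
      ← mul_assoc b b, hb, one_mul, mul_assoc, (hac.mul_right hab).eq]
  have hord : orderOf (a * (b * c)) = 6 := by
    refine orderOf_eq_of_pow_and_pow_div_prime (by norm_num) h6 fun p hp hdvd => ?_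
    have hp' : p = 2 ∨ p = 3 := by
      rw [show 6 = 2 * 3 from rfl, hp.dvd_mul, Nat.prime_dvd_prime_iff_eq hp Nat.prime_two,
        Nat.prime_dvd_prime_iff_eq hp Nat.prime_three] at hdvd
      exact hdvd
    rcases hp' with rfl | rfl
    · exact h3.symm ▸ ha1
    · exact h2
  have hmem : b ∉ Subgroup.zpowers (a * (b * c)) := by
    rintro ⟨k, hk⟩
    have hk' : Commute b (a * (b * c)) := by
      have := (Commute.refl (a * (b * c))).zpow_left k
      rwa [show (a * (b * c)) ^ k = b from hk] at this
    rw [hk'.eq, mul_inv_cancel_right, ← mul_eq_one_iff_eq_inv, ← sq] at hconj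
    exact h2 hconj
  have hclosure : Subgroup.closure {a, b, c} = Subgroup.closure {a * (b * c), b} := by
    apply le_antisymm <;> rw [Subgroup.closure_le]
    · have hr : a * (b * c) ∈ Subgroup.closure {a * (b * c), b} :=
        Subgroup.subset_closure (by simp)
      have hs : b ∈ Subgroup.closure {a * (b * c), b} := Subgroup.subset_closure (by simp)
      have hmem_c := mul_mem hs (pow_mem hr 4)
      rw [h4, ← mul_assoc b b c, hb, one_mul] at hmem_c
      have hmem_a := pow_mem hr 3
      rw [h3] at hmem_a
      simp [Set.insert_subset_iff, hmem_a, hs, hmem_c]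
    · have hmem' : ∀ x ∈ ({a, b, c} : Set G), x ∈ Subgroup.closure {a, b, c} :=
        fun x hx => Subgroup.subset_closure hx
      rintro _ (rfl | rfl)
      · exact mul_mem (hmem' a (by simp)) (mul_mem (hmem' b (by simp)) (hmem' c (by simp)))
      · exact hmem' _ (by simp)
  exact ⟨(MulEquiv.subgroupCongr
    (hclosure.trans (DihedralGroup.range_lift h6 hb hconj).symm)).trans
    (MonoidHom.ofInjective (DihedralGroup.lift_injective h6 hb hconj hord hmem)).symm⟩

theorem algEquiv_ext_of_Xv {f g : K ≃ₐ[ℚ] K} (h0 : f (Xv 0) = g (Xv 0))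
    (h1 : f (Xv 1) = g (Xv 1)) (h2 : f (Xv 2) = g (Xv 2)) : f = g := by
  have hring : (f : K →+* K) = (g : K →+* K) := by
    apply IsLocalization.ringHom_ext (nonZeroDivisors (MvPolynomial (Fin 3) ℚ))
    refine MvPolynomial.ringHom_ext (fun q => ?_) fun i => ?_
    · exact congrFun (congrArg DFunLike.coe (Subsingleton.elim
        (((f : K →+* K).comp (algebraMap _ K)).comp MvPolynomial.C)
        (((g : K →+* K).comp (algebraMap _ K)).comp MvPolynomial.C))) q
    · fin_cases i
      exacts [h0, h1, h2]
  exact AlgEquiv.ext fun x => congrFun (congrArg DFunLike.coe hring) x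

theorem Xv_ne_zero (i : Fin 3) : Xv i ≠ 0 :=
  (map_ne_zero_iff _ (IsFractionRing.injective (MvPolynomial (Fin 3) ℚ) K)).2
    (MvPolynomial.X_ne_zero i)

theorem Xv_one_sq_ne : Xv 1 ^ 2 ≠ Xv 2 := by
  intro h
  simp only [Xv, ← map_pow] at h
  have h' := congrArg (MvPolynomial.eval fun i => if i = 1 then 2 else 1)
    (IsFractionRing.injective (MvPolynomial (Fin 3) ℚ) K h)
  norm_num [show (2 : Fin 3) ≠ 1 by decide] at h'

theorem Xv_zero_sq_mul_ne :
    Xv 0 ^ 2 * Xv 1 * Xv 2 ≠ Xv 1 * Xv 2 ^ 2 + Xv 1 ^ 2 + Xv 2 := by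
  intro h
  simp only [Xv, ← map_pow, ← map_mul, ← map_add] at h
  have h' := congrArg (MvPolynomial.eval fun i => if i = 0 then 0 else 1)
    (IsFractionRing.injective (MvPolynomial (Fin 3) ℚ) K h)
  norm_num [show (2 : Fin 3) ≠ 0 by decide] at h'

/-- Let `φ_x, φ_y, φ_z` be the automorphisms of `ℚ(x,y,z)` determined by
`φ_x : x ↦ (yz²+y²+z)/(xyz), y ↦ y, z ↦ z`;
`φ_y : x ↦ x, y ↦ z/y, z ↦ z`;
`φ_z : x ↦ x, y ↦ y, z ↦ y/z`.
Then the subgroup of automorphisms of `ℚ(x,y,z)` they generate is isomorphic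
to the dihedral group of order 12. -/
theorem group_of_model_dihedral (φx φy φz : K ≃ₐ[ℚ] K)
    (hxx : φx (Xv 0) = (Xv 1 * Xv 2 ^ 2 + Xv 1 ^ 2 + Xv 2) / (Xv 0 * Xv 1 * Xv 2))
    (hxy : φx (Xv 1) = Xv 1) (hxz : φx (Xv 2) = Xv 2)
    (hyx : φy (Xv 0) = Xv 0) (hyy : φy (Xv 1) = Xv 2 / Xv 1)
    (hyz : φy (Xv 2) = Xv 2)
    (hzx : φz (Xv 0) = Xv 0) (hzy : φz (Xv 1) = Xv 1)
    (hzz : φz (Xv 2) = Xv 1 / Xv 2) :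
    Nonempty ((Subgroup.closure {φx, φy, φz} : Subgroup (K ≃ₐ[ℚ] K)) ≃*
      DihedralGroup 6) := by
  have hx0 := Xv_ne_zero 0
  have hy0 := Xv_ne_zero 1
  have hz0 := Xv_ne_zero 2
  have hw : Xv 1 * Xv 2 ^ 2 + Xv 1 ^ 2 + Xv 2 ≠ 0 := by
    intro h
    rw [h, zero_div, map_eq_zero] at hxx
    exact hx0 hxx
  refine nonempty_closure_mulEquiv_dihedralGroup_six ?_ ?_ ?_ ?_ ?_ ?_ ?_ ?_
  · apply algEquiv_ext_of_Xv <;> simp [hxx, hxy, hxz]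
    field_simp
    rw [div_eq_one_iff_eq]
    convert hw using 1
    ring
  · apply algEquiv_ext_of_Xv <;> simp [hyx, hyy, hyz]
    field_simp
  · apply algEquiv_ext_of_Xv <;> simp [hzx, hzy, hzz]
    field_simp
  · apply algEquiv_ext_of_Xv <;> simp [hxx, hxy, hxz, hyx, hyy, hyz]
    field_simp
    ring
  · apply algEquiv_ext_of_Xv <;> simp [hxx, hxy, hxz, hzx, hzy, hzz]
    field_simp
    ring
  · apply algEquiv_ext_of_Xv <;> simp [pow_succ, hyx, hyy, hyz, hzx, hzy, hzz] <;>
      field_simp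
  · rintro rfl
    rw [AlgEquiv.one_apply, eq_div_iff (mul_ne_zero (mul_ne_zero hx0 hy0) hz0)] at hxx
    exact Xv_zero_sq_mul_ne (by rw [← hxx]; ring)
  · rintro rfl
    rw [hzy, eq_div_iff hy0, ← sq] at hyy
    exact Xv_one_sq_ne hyy
end
end

section
/- Let φ_x, φ_y, φ_z be the field automorphisms of ℚ(x,y,z) determined by φ_x: x ↦ (yz²+y²+z)/(xyz), y ↦ y, z ↦ z; φ_y: x ↦ x, y ↦ z/y, z ↦ z; φ_z: x ↦ x, y ↦ y, z ↦ y/z, and let G be the subgroup of automorphisms of ℚ(x,y,z) they generate. Then there exists a group homomorphism sgn : G → {±1} with sgn(φ_x) = sgn(φ_y) = sgn(φ_z) = −1. -/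
noncomputable section

/-- If every generator negates `f ≠ 0`, then the eigenvalue at `f` is a `±1`-valued character of the
group they generate. -/
theorem exists_hom_of_eigenvector {S : Set (K ≃ₐ[ℚ] K)} {f : K} (hf : f ≠ 0)
    (hS : ∀ g ∈ S, g f = -f) :
    ∃ sgn : Subgroup.closure S →* ℤˣ, ∀ g : Subgroup.closure S,
      (g : K ≃ₐ[ℚ] K) ∈ S → sgn g = -1 := by
  have hex : ∀ g ∈ Subgroup.closure S, ∃ u : ℤˣ, g f = ((u : ℤ) : K) * f := by
    intro g hg
    induction hg using Subgroup.closure_induction with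
    | mem g hg => exact ⟨-1, by simp [hS g hg]⟩
    | one => exact ⟨1, by simp⟩
    | mul a b _ _ ha hb =>
      obtain ⟨u, hu⟩ := ha
      obtain ⟨v, hv⟩ := hb
      refine ⟨u * v, ?_⟩
      rw [AlgEquiv.mul_apply, hv, map_mul, map_intCast, hu]
      push_cast
      ring
    | inv a _ ha =>
      obtain ⟨u, hu⟩ := ha
      refine ⟨u, a.injective ?_⟩
      have huu : ((u : ℤ) : K) * ((u : ℤ) : K) = 1 := by
        rw [← Int.cast_mul, ← Units.val_mul, Int.units_mul_self]
        simp
      have haa : a (a⁻¹ f) = f := by rw [← AlgEquiv.mul_apply, mul_inv_cancel]; rfl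
      rw [haa, map_mul, map_intCast, hu, ← mul_assoc, huu, one_mul]
  have huniq : ∀ u v : ℤˣ, ((u : ℤ) : K) * f = ((v : ℤ) : K) * f → u = v := fun u v h =>
    Units.ext (Int.cast_injective (mul_right_cancel₀ hf h))
  choose s hs using fun g : Subgroup.closure S => hex g g.2
  refine ⟨MonoidHom.mk' s fun a b => huniq _ _ ?_, fun g hg => huniq _ _ ?_⟩
  · rw [← hs, Subgroup.coe_mul, AlgEquiv.mul_apply, hs, map_mul, map_intCast, hs]
    push_cast
    ring
  · rw [MonoidHom.mk'_apply, ← hs, hS _ hg]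
    simp

theorem algebraMap_ne_zero_of_eval {p : MvPolynomial (Fin 3) ℚ} (v : Fin 3 → ℚ)
    (hp : MvPolynomial.eval v p ≠ 0) : algebraMap (MvPolynomial (Fin 3) ℚ) K p ≠ 0 := by
  intro h
  apply hp
  rw [(map_eq_zero_iff _ (IsFractionRing.injective (MvPolynomial (Fin 3) ℚ) K)).1 h, map_zero]

/-- With `a = z`, `b = y/z`, `c = 1/y`, this is `(x - (a + b + c)/x)(a - b)(b - c)(c - a)`. -/
def alternant : K :=
  (Xv 0 - (Xv 2 + Xv 1 / Xv 2 + 1 / Xv 1) / Xv 0) *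
    ((Xv 2 - Xv 1 / Xv 2) * (Xv 1 / Xv 2 - 1 / Xv 1) * (1 / Xv 1 - Xv 2))

theorem alternant_ne_zero : alternant ≠ 0 := by
  have hx := Xv_ne_zero 0
  have hy := Xv_ne_zero 1
  have hz := Xv_ne_zero 2
  have key : alternant * (Xv 0 * Xv 1 ^ 3 * Xv 2 ^ 3) =
      (Xv 0 ^ 2 * Xv 1 * Xv 2 - (Xv 1 * Xv 2 ^ 2 + Xv 1 ^ 2 + Xv 2)) *
        ((Xv 2 ^ 2 - Xv 1) * (Xv 1 ^ 2 - Xv 2) * (1 - Xv 1 * Xv 2)) := by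
    unfold alternant
    field_simp
  refine left_ne_zero_of_mul (b := Xv 0 * Xv 1 ^ 3 * Xv 2 ^ 3) ?_
  rw [key]
  unfold Xv
  simp only [← map_mul, ← map_pow, ← map_sub, ← map_add,
    ← map_one (algebraMap (MvPolynomial (Fin 3) ℚ) K)]
  exact algebraMap_ne_zero_of_eval ![5, 2, 3] (by simp; norm_num)

/-- Let `φ_x, φ_y, φ_z` be the automorphisms of `ℚ(x,y,z)` determined by
`φ_x : x ↦ (yz²+y²+z)/(xyz), y ↦ y, z ↦ z`;
`φ_y : x ↦ x, y ↦ z/y, z ↦ z`;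
`φ_z : x ↦ x, y ↦ y, z ↦ y/z`,
and let `G` be the subgroup of automorphisms of `ℚ(x,y,z)` they generate.
Then there is a group homomorphism `sgn : G → {±1}` sending each of the three
generators to `−1`. -/
theorem sign_homomorphism_exists (φx φy φz : K ≃ₐ[ℚ] K)
    (hxx : φx (Xv 0) = (Xv 1 * Xv 2 ^ 2 + Xv 1 ^ 2 + Xv 2) / (Xv 0 * Xv 1 * Xv 2))
    (hxy : φx (Xv 1) = Xv 1) (hxz : φx (Xv 2) = Xv 2)
    (hyx : φy (Xv 0) = Xv 0) (hyy : φy (Xv 1) = Xv 2 / Xv 1)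
    (hyz : φy (Xv 2) = Xv 2)
    (hzx : φz (Xv 0) = Xv 0) (hzy : φz (Xv 1) = Xv 1)
    (hzz : φz (Xv 2) = Xv 1 / Xv 2) :
    ∃ sgn : (Subgroup.closure {φx, φy, φz} : Subgroup (K ≃ₐ[ℚ] K)) →* ℤˣ,
      sgn ⟨φx, Subgroup.subset_closure (Set.mem_insert _ _)⟩ = -1 ∧
      sgn ⟨φy, Subgroup.subset_closure
        (Set.mem_insert_of_mem _ (Set.mem_insert _ _))⟩ = -1 ∧
      sgn ⟨φz, Subgroup.subset_closure
        (Set.mem_insert_of_mem _ (Set.mem_insert_of_mem _ rfl))⟩ = -1 := by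
  have hx := Xv_ne_zero 0
  have hy := Xv_ne_zero 1
  have hz := Xv_ne_zero 2
  obtain ⟨sgn, hsgn⟩ := exists_hom_of_eigenvector (S := {φx, φy, φz}) alternant_ne_zero (by
    rintro g (rfl | rfl | rfl)
    · simp only [alternant, map_mul, map_sub, map_add, map_div₀, map_one, hxx, hxy, hxz]
      have hP : Xv 1 * Xv 2 ^ 2 + Xv 1 ^ 2 + Xv 2 ≠ 0 := by
        intro h
        apply hx
        apply g.injective
        rw [hxx, h, zero_div, map_zero]
      have hQ : Xv 2 + Xv 1 / Xv 2 + 1 / Xv 1 =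
          (Xv 1 * Xv 2 ^ 2 + Xv 1 ^ 2 + Xv 2) / (Xv 1 * Xv 2) := by
        field_simp
      rw [hQ]
      generalize Xv 1 * Xv 2 ^ 2 + Xv 1 ^ 2 + Xv 2 = P at hP
      field_simp
      ring
    · simp only [alternant, map_mul, map_sub, map_add, map_div₀, map_one, hyx, hyy, hyz]
      field_simp
      ring
    · simp only [alternant, map_mul, map_sub, map_add, map_div₀, map_one, hzx, hzy, hzz]
      field_simp
      ring)
  exact ⟨sgn, hsgn _ (by simp), hsgn _ (by simp), hsgn _ (by simp)⟩
end
end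

section
/- The cone C_G ⊆ ℝ⁴ generated by the six vectors (1,1,1,1), (1,−1,2,1), (0,1,−2,0), (−1,−1,3,1), (0,−1,−1,0), (−1,1,2,1) is line-free; that is, C_G ∩ (−C_G) = {0}. -/
/-- The cone in `ℝ⁴` generated by finitely many vectors: all linear
combinations with nonnegative real coefficients. -/
def coneOf {m : ℕ} (g : Fin m → (Fin 4 → ℝ)) : Set (Fin 4 → ℝ) :=
  {v | ∃ c : Fin m → ℝ, (∀ i, 0 ≤ c i) ∧ v = ∑ i, c i • g i}

/-- A cone whose generators all lie in an open half-space is line-free. -/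
theorem coneOf_inter_neg_eq_zero {m : ℕ} (g : Fin m → (Fin 4 → ℝ))
    (f : (Fin 4 → ℝ) →ₗ[ℝ] ℝ) (hf : ∀ i, 0 < f (g i)) :
    coneOf g ∩ (-(coneOf g)) = {0} := by
  have f_nonneg : ∀ v ∈ coneOf g, 0 ≤ f v := by
    rintro v ⟨c, hc, rfl⟩
    simp only [map_sum, map_smul, smul_eq_mul]
    exact Finset.sum_nonneg fun i _ => mul_nonneg (hc i) (hf i).le
  apply Set.Subset.antisymm
  · rintro v ⟨hv, hv_neg⟩
    have hfv : f v ≤ 0 := by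
      have := f_nonneg (-v) hv_neg
      rw [map_neg] at this
      linarith
    obtain ⟨c, hc, rfl⟩ := hv
    simp only [map_sum, map_smul, smul_eq_mul] at hfv
    have terms_nonneg : ∀ i ∈ Finset.univ, 0 ≤ c i * f (g i) :=
      fun i _ => mul_nonneg (hc i) (hf i).le
    have terms_zero := (Finset.sum_eq_zero_iff_of_nonneg terms_nonneg).1
      (le_antisymm hfv (Finset.sum_nonneg terms_nonneg))
    refine Finset.sum_eq_zero fun i hi => ?_
    rw [(mul_eq_zero.1 (terms_zero i hi)).resolve_right (hf i).ne', zero_smul]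
  · have zero_mem : (0 : Fin 4 → ℝ) ∈ coneOf g := ⟨0, fun _ => le_rfl, by simp⟩
    rintro v rfl
    exact ⟨zero_mem, by simpa using zero_mem⟩

/-- The cone `C_G ⊆ ℝ⁴` generated by the six vectors `(1,1,1,1)`, `(1,−1,2,1)`,
`(0,1,−2,0)`, `(−1,−1,3,1)`, `(0,−1,−1,0)`, `(−1,1,2,1)` is line-free:
`C_G ∩ (−C_G) = {0}`. -/
theorem coneCG_line_free :
    coneOf ![![1,1,1,1], ![1,-1,2,1], ![0,1,-2,0],
             ![-1,-1,3,1], ![0,-1,-1,0], ![-1,1,2,1]] ∩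
    (-(coneOf ![![1,1,1,1], ![1,-1,2,1], ![0,1,-2,0],
             ![-1,-1,3,1], ![0,-1,-1,0], ![-1,1,2,1]])) = {0} := by
  apply coneOf_inter_neg_eq_zero _ ((4 : ℝ) • LinearMap.proj 3 - LinearMap.proj 2)
  have eval_pos (v : Fin 4 → ℝ) (hv : v 2 < 4 * v 3) :
      0 < ((4 : ℝ) • LinearMap.proj 3 - LinearMap.proj 2 : (Fin 4 → ℝ) →ₗ[ℝ] ℝ) v := by
    simpa using hv
  intro i
  apply eval_pos
  fin_cases i <;> simp <;> norm_num
end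

section
/- Let C ⊆ ℝ^n be a cone generated by finitely many vectors of ℤ^n, and suppose C is line-free, i.e., C ∩ (−C) = {0}. Then for every v ∈ ℤ^n, the set {(a,b) ∈ (C ∩ ℤ^n) × (C ∩ ℤ^n) : a + b = v} is finite. -/
/-- The nonzero part of a line-free cone is convex. -/
theorem convex_diff_zero_of_lineFree {E : Type*} [AddCommGroup E] [Module ℝ E] {C : Set E}
    (hadd : ∀ x ∈ C, ∀ y ∈ C, x + y ∈ C) (hsmul : ∀ t : ℝ, 0 ≤ t → ∀ x ∈ C, t • x ∈ C)
    (hline : C ∩ (-C) = {0}) : Convex ℝ (C \ {0}) := by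
  rintro x ⟨hx, hx0⟩ y ⟨hy, hy0⟩ s t hs ht hst
  refine ⟨hadd _ (hsmul s hs x hx) _ (hsmul t ht y hy), fun h => ?_⟩
  rw [Set.mem_singleton_iff] at h hx0 hy0
  have hsx : s • x = 0 := by
    have hmem : s • x ∈ C ∩ (-C) := by
      refine ⟨hsmul s hs x hx, ?_⟩
      rw [Set.mem_neg, ← eq_neg_of_add_eq_zero_right h]
      exact hsmul t ht y hy
    rwa [hline] at hmem
  have hty : t • y = 0 := by rwa [hsx, zero_add] at h
  have hs0 : s = 0 := (smul_eq_zero.1 hsx).resolve_right hx0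
  have ht0 : t = 0 := (smul_eq_zero.1 hty).resolve_right hy0
  linarith

/-- Finitely many nonzero vectors of a line-free cone admit a common linear functional that is
positive on each of them. -/
theorem exists_pos_functional_of_lineFree {E : Type*} [NormedAddCommGroup E] [NormedSpace ℝ E]
    {C : Set E} (hadd : ∀ x ∈ C, ∀ y ∈ C, x + y ∈ C)
    (hsmul : ∀ t : ℝ, 0 ≤ t → ∀ x ∈ C, t • x ∈ C) (hline : C ∩ (-C) = {0})
    {s : Set E} (hs : s.Finite) (hsC : s ⊆ C \ {0}) :
    ∃ f : E →L[ℝ] ℝ, ∀ x ∈ s, 0 < f x := by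
  have h0 : (0 : E) ∉ convexHull ℝ s := fun h =>
    (convexHull_min hsC (convex_diff_zero_of_lineFree hadd hsmul hline) h).2 rfl
  obtain ⟨f, u, hu, hf⟩ := geometric_hahn_banach_point_closed (convex_convexHull ℝ s)
    (hs.isClosed_convexHull ℝ) h0
  rw [map_zero] at hu
  exact ⟨f, fun x hx => hu.trans (hf x (subset_convexHull ℝ s hx))⟩


/-- Let `C ⊆ ℝ^n` be the cone generated by finitely many integer vectors
`g 0, …, g (m-1) ∈ ℤ^n` (all nonnegative real linear combinations), and
suppose `C` is line-free: `C ∩ (−C) = {0}`. Then for every `v ∈ ℤ^n`, there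
are only finitely many pairs `(a, b)` of integer points of `C` with
`a + b = v`. -/
theorem finitely_many_decompositions {n m : ℕ} (g : Fin m → (Fin n → ℤ))
    (C : Set (Fin n → ℝ))
    (hC : C = {v | ∃ c : Fin m → ℝ, (∀ i, 0 ≤ c i) ∧
      v = ∑ i, c i • (fun j => ((g i j : ℝ)))})
    (hline : C ∩ (-C) = {0}) (v : Fin n → ℤ) :
    {ab : (Fin n → ℤ) × (Fin n → ℤ) |
      (fun j => ((ab.1 j : ℝ))) ∈ C ∧ (fun j => ((ab.2 j : ℝ))) ∈ C ∧
      ab.1 + ab.2 = v}.Finite := by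
  set G : Fin m → (Fin n → ℝ) := fun i j => (g i j : ℝ) with hG
  have hmem : ∀ x, x ∈ C ↔ ∃ c : Fin m → ℝ, (∀ i, 0 ≤ c i) ∧ x = ∑ i, c i • G i := by
    intro x; rw [hC]; rfl
  have hadd : ∀ x ∈ C, ∀ y ∈ C, x + y ∈ C := by
    simp only [hmem]
    rintro _ ⟨c, hc, rfl⟩ _ ⟨d, hd, rfl⟩
    exact ⟨c + d, fun i => add_nonneg (hc i) (hd i), by
      simp only [Pi.add_apply, add_smul, Finset.sum_add_distrib]⟩
  have hsmul : ∀ t : ℝ, 0 ≤ t → ∀ x ∈ C, t • x ∈ C := by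
    simp only [hmem]
    rintro t ht _ ⟨c, hc, rfl⟩
    exact ⟨t • c, fun i => mul_nonneg ht (hc i), by
      simp only [Pi.smul_apply, smul_assoc, Finset.smul_sum]⟩
  have hGC : ∀ i, G i ∈ C := fun i => (hmem _).2
    ⟨Pi.single i 1, fun k => by by_cases h : k = i <;> simp [h],
      by simp [Pi.single_apply]⟩
  obtain ⟨f, hf⟩ := exists_pos_functional_of_lineFree hadd hsmul hline
    (s := Set.range G \ {0}) ((Set.finite_range G).sdiff)
    (Set.sdiff_subset_sdiff_left (Set.range_subset_iff.2 hGC))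
  have hfG : ∀ i, 0 ≤ f (G i) := fun i => by
    by_cases h : G i = 0
    · simp [h]
    · exact (hf _ ⟨⟨i, rfl⟩, h⟩).le
  have hfsum : ∀ c : Fin m → ℝ, f (∑ i, c i • G i) = ∑ i, c i * f (G i) := fun c => by
    simp [map_sum]
  have hfC : ∀ x ∈ C, 0 ≤ f x := by
    intro x hx
    obtain ⟨c, hc, rfl⟩ := (hmem x).1 hx
    rw [hfsum]
    exact Finset.sum_nonneg fun i _ => mul_nonneg (hc i) (hfG i)
  set B : ℝ := f fun j => (v j : ℝ) with hB
  have hbound : ∀ x ∈ C, f x ≤ B → ∀ j, |x j| ≤ ∑ i, B / f (G i) * |G i j| := by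
    intro x hx hxB j
    obtain ⟨c, hc, rfl⟩ := (hmem x).1 hx
    rw [Finset.sum_apply]
    refine (Finset.abs_sum_le_sum_abs _ _).trans (Finset.sum_le_sum fun i _ => ?_)
    rw [Pi.smul_apply, smul_eq_mul, abs_mul, abs_of_nonneg (hc i)]
    by_cases h : G i = 0
    · simp [h]
    · refine mul_le_mul_of_nonneg_right ?_ (abs_nonneg _)
      rw [le_div_iff₀ (hf _ ⟨⟨i, rfl⟩, h⟩)]
      rw [hfsum] at hxB
      exact (Finset.single_le_sum (f := fun i => c i * f (G i))
        (fun k _ => mul_nonneg (hc k) (hfG k)) (Finset.mem_univ i)).trans hxB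
  set M : Fin n → ℤ := fun j => ⌊∑ i, B / f (G i) * |G i j|⌋
  have hbox : ∀ a b : Fin n → ℤ, (fun j => (a j : ℝ)) ∈ C → (fun j => (b j : ℝ)) ∈ C →
      a + b = v → a ∈ Set.Icc (-M) M := by
    intro a b ha hb hab
    have hsum : f (fun j => (a j : ℝ)) + f (fun j => (b j : ℝ)) = B := by
      rw [hB, ← map_add, ← hab]
      congr 1
      ext j
      simp
    have hj : ∀ j, |a j| ≤ M j := fun j => by
      have := hbound _ ha (by linarith [hfC _ hb]) j
      exact Int.le_floor.2 (by simpa using this)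
    exact ⟨fun j => (abs_le.1 (hj j)).1, fun j => (abs_le.1 (hj j)).2⟩
  refine ((Set.finite_Icc (-M) M).prod (Set.finite_Icc (-M) M)).subset ?_
  rintro ⟨a, b⟩ ⟨ha, hb, hab⟩
  exact ⟨hbox a b ha hb hab, hbox b a hb ha (by rw [add_comm]; exact hab)⟩
end
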